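/- arXiv:1704.00481 — 4 statements merged into one kernel-verified Lean document; each statement's English description precedes it below -/
import Mathlib

section
/- Let T > 0, I = [0,T], and let b : I × ℝ^d → ℝ^d be a bounded Borel vector field. Suppose μ̄ is a locally finite nonnegative Borel measure on ℝ^d and there exists a Borel function F : ℝ^d → Γ such that for every x ∈ ℝ^d the curve F(x) is an integral curve of b with F(x)(0) = x. Then there exists a measurable family {μ_t}_{t∈I} of locally finite Borel measures on ℝ^d that is a measure-valued solution of ∂_t μ_t + div(b μ_t) = 0 with initial condition μ_0 = μ̄. -/
open MeasureTheory Set Metric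

noncomputable section

/-- The space `C(I; E)` of continuous curves on `I = [0,T]`, with the sup metric. -/
abbrev Curve (T : ℝ) (E : Type*) [MetricSpace E] := C(Set.Icc (0:ℝ) T, E)

instance (T : ℝ) (E : Type*) [MetricSpace E] : MeasurableSpace (Curve T E) := borel _
instance (T : ℝ) (E : Type*) [MetricSpace E] : BorelSpace (Curve T E) := ⟨rfl⟩

/-- `Γ = Lip_M(I; E)` : the curves that are Lipschitz with constant `M`, as a metric
subspace of `C(I; E)`. -/
abbrev LipCurve (T : ℝ) (E : Type*) [MetricSpace E] (M : NNReal) :=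
  {γ : Curve T E // LipschitzWith M γ}

/-- Evaluation of a curve `γ ∈ C([0,T]; E)` at a time `t : ℝ` (clamping `t` to `[0,T]`). -/
def evalC {T : ℝ} {E : Type*} [MetricSpace E] (hT : 0 ≤ T) (γ : Curve T E) (t : ℝ) : E :=
  γ (Set.projIcc 0 T hT t)

/-- `γ` is an integral curve of `b`: `γ(t) = γ(0) + ∫₀ᵗ b(s, γ(s)) ds` for all `t ∈ [0,T]`. -/
def IsIntegralCurveOf {T : ℝ} {E : Type*} [NormedAddCommGroup E] [NormedSpace ℝ E]
    (hT : 0 ≤ T) (b : ℝ → E → E) (γ : Curve T E) : Prop :=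
  ∀ t ∈ Set.Icc (0:ℝ) T,
    evalC hT γ t = evalC hT γ 0 + ∫ s in (0:ℝ)..t, b s (evalC hT γ s)

/-- A family `{μ_t}` of Borel measures is measurable: `t ↦ μ_t(B)` is (Lebesgue-)measurable
for every bounded Borel set `B`, and `t ↦ μ_t(K)` is integrable on `[0,T]` for every
compact `K`. -/
def IsMeasurableFamily {E : Type*} [NormedAddCommGroup E] [MeasurableSpace E]
    (T : ℝ) (μ : ℝ → Measure E) : Prop :=
  (∀ B : Set E, MeasurableSet B → Bornology.IsBounded B →
      AEMeasurable (fun t => μ t B) (volume.restrict (Set.Icc (0:ℝ) T))) ∧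
  (∀ K : Set E, IsCompact K →
      IntegrableOn (fun t => (μ t K).toReal) (Set.Icc (0:ℝ) T))

/-- `{μ_t}` is a measure-valued solution of `∂_t μ_t + div (b μ_t) = 0`, `μ_t|_{t=0} = μ₀`:
for every `C¹` test function `φ(t,x)` vanishing for `(t,x) ∈ [0,T] × (E ∖ B_R(0))` for
some `R > 0`, and a.e. `t ∈ [0,T]`,
`∫ φ(t,x) dμ_t(x) = ∫ φ(0,x) dμ₀(x) + ∫₀ᵗ ∫ (∂_t φ + b ⬝ ∇_x φ) dμ_s ds`. -/
def IsMVSolution {E : Type*} [NormedAddCommGroup E] [NormedSpace ℝ E] [MeasurableSpace E]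
    (T : ℝ) (b : ℝ → E → E) (μ : ℝ → Measure E) (μ₀ : Measure E) : Prop :=
  ∀ φ : ℝ × E → ℝ, ContDiff ℝ 1 φ →
    (∃ R > (0:ℝ), ∀ t ∈ Set.Icc (0:ℝ) T, ∀ x : E, R ≤ ‖x‖ → φ (t, x) = 0) →
    ∀ᵐ t ∂(volume.restrict (Set.Icc (0:ℝ) T)),
      ∫ x, φ (t, x) ∂(μ t) =
        (∫ x, φ (0, x) ∂μ₀) +
          ∫ s in (0:ℝ)..t, (∫ x, (deriv (fun τ => φ (τ, x)) s
            + fderiv ℝ (fun y => φ (s, y)) x (b s x)) ∂(μ s))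


section FlowLemmas

variable {E : Type*} [NormedAddCommGroup E]

lemma dist_evalC_le {X : Type*} [MetricSpace X] {T : ℝ} (hT : 0 ≤ T) {M : NNReal}
    (γ : LipCurve T X M) (s t : ℝ) : dist (evalC hT γ.1 s) (evalC hT γ.1 t) ≤ M * dist s t := by
  have h := (γ.2.comp (LipschitzWith.projIcc hT)).dist_le_mul s t
  simpa [evalC] using h

lemma continuous_evalC {X : Type*} [MetricSpace X] {T : ℝ} (hT : 0 ≤ T) (γ : Curve T X) :
    Continuous (evalC hT γ) :=
  γ.continuous.comp continuous_projIcc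

/-- A curve with Lipschitz constant `M` on `[0,T]` stays within `M * T` of its starting point. -/
lemma dist_evalC_zero_le {X : Type*} [MetricSpace X] {T : ℝ} (hT : 0 ≤ T) {M : NNReal}
    (γ : LipCurve T X M) (t : ℝ) : dist (evalC hT γ.1 t) (evalC hT γ.1 0) ≤ M * T := by
  have h := γ.2.dist_le_mul (projIcc 0 T hT t) (projIcc 0 T hT 0)
  refine h.trans (mul_le_mul_of_nonneg_left ?_ M.2)
  have h1 := Real.dist_le_of_mem_Icc (projIcc 0 T hT t).2 (projIcc 0 T hT 0).2
  simpa [Subtype.dist_eq] using h1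

lemma intervalIntegrable_comp_evalC [MeasurableSpace E] [BorelSpace E]
    [SecondCountableTopology E] {T : ℝ} (hT : 0 ≤ T) {b : ℝ → E → E}
    (hb : Measurable (Function.uncurry b)) {M : NNReal}
    (hb_bdd : ∀ t ∈ Icc (0:ℝ) T, ∀ x, ‖b t x‖ ≤ M) (γ : Curve T E) :
    IntervalIntegrable (fun s => b s (evalC hT γ s)) volume 0 T := by
  rw [intervalIntegrable_iff_integrableOn_Icc_of_le hT]
  have hm : Measurable fun s => b s (evalC hT γ s) :=
    hb.comp (measurable_id.prodMk (continuous_evalC hT γ).measurable)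
  exact Measure.integrableOn_of_bounded (M := M) measure_Icc_lt_top.ne hm.aestronglyMeasurable
    (ae_restrict_of_forall_mem measurableSet_Icc fun s hs => hb_bdd s hs _)

variable [NormedSpace ℝ E]

/-- An integral curve of a bounded Borel field solves the ODE at almost every time. -/
lemma IsIntegralCurveOf.ae_hasDerivAt [MeasurableSpace E] [BorelSpace E]
    [SecondCountableTopology E] [CompleteSpace E] {T : ℝ} {hT : 0 ≤ T} {b : ℝ → E → E}
    (hb : Measurable (Function.uncurry b)) {M : NNReal}
    (hb_bdd : ∀ t ∈ Icc (0:ℝ) T, ∀ x, ‖b t x‖ ≤ M) {γ : Curve T E}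
    (hγ : IsIntegralCurveOf hT b γ) :
    ∀ᵐ s, s ∈ Ioo 0 T → HasDerivAt (evalC hT γ) (b s (evalC hT γ s)) s := by
  filter_upwards [(intervalIntegrable_comp_evalC hT hb hb_bdd γ).ae_hasDerivAt_integral]
    with s hs hmem
  have h := (hs (by rw [uIcc_of_le hT]; exact Ioo_subset_Icc_self hmem) 0 left_mem_uIcc).const_add
    (evalC hT γ 0)
  refine h.congr_of_eventuallyEq ?_
  filter_upwards [Ioo_mem_nhds hmem.1 hmem.2] with r hr
  exact hγ r (Ioo_subset_Icc_self hr)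

/-- The integrated chain rule for a `C¹` function along a Lipschitz integral curve. -/
lemma IsIntegralCurveOf.comp_eq_add_integral [MeasurableSpace E] [BorelSpace E]
    [FiniteDimensional ℝ E] {T : ℝ} {hT : 0 ≤ T} {b : ℝ → E → E}
    (hb : Measurable (Function.uncurry b)) {M : NNReal}
    (hb_bdd : ∀ t ∈ Icc (0:ℝ) T, ∀ x, ‖b t x‖ ≤ M) {γ : LipCurve T E M}
    (hγ : IsIntegralCurveOf hT b γ.1) {φ : ℝ × E → ℝ} (hφ : ContDiff ℝ 1 φ)
    {t : ℝ} (ht : t ∈ Icc 0 T) :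
    φ (t, evalC hT γ.1 t) = φ (0, evalC hT γ.1 0) +
      ∫ s in (0:ℝ)..t, fderiv ℝ φ (s, evalC hT γ.1 s) (1, b s (evalC hT γ.1 s)) := by
  have := FiniteDimensional.complete ℝ E
  have := FiniteDimensional.proper ℝ E
  set c : ℝ → ℝ × E := fun s => (s, evalC hT γ.1 s) with hc
  have hc_lip : LipschitzWith (max 1 M) c :=
    LipschitzWith.id.prodMk (LipschitzWith.of_dist_le_mul (dist_evalC_le hT γ))
  set K : Set (ℝ × E) := Icc 0 T ×ˢ closedBall (evalC hT γ.1 0) (M * T)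
  obtain ⟨C, hC⟩ : ∃ C, LipschitzOnWith C φ K :=
    hφ.contDiffOn.exists_lipschitzOnWith one_ne_zero
      ((convex_Icc 0 T).prod (convex_closedBall _ _)) (isCompact_Icc.prod (isCompact_closedBall _ _))
  have hcK : MapsTo c (Icc 0 T) K := fun s hs => ⟨hs, dist_evalC_zero_le hT γ s⟩
  have hsub : uIcc 0 t ⊆ Icc 0 T := by
    rw [uIcc_of_le ht.1]; exact Icc_subset_Icc_right ht.2
  have hac : AbsolutelyContinuousOnInterval (φ ∘ c) 0 t :=
    ((hC.comp hc_lip.lipschitzOnWith hcK).mono hsub).absolutelyContinuousOnInterval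
  have hderiv : ∀ᵐ s, s ∈ Ioo 0 T →
      deriv (φ ∘ c) s = fderiv ℝ φ (c s) (1, b s (evalC hT γ.1 s)) := by
    filter_upwards [hγ.ae_hasDerivAt hb hb_bdd] with s hs hmem
    exact (((hφ.differentiable one_ne_zero) (c s)).hasFDerivAt.comp_hasDerivAt s
      ((hasDerivAt_id s).prodMk (hs hmem))).deriv
  have hint : ∫ s in (0:ℝ)..t, deriv (φ ∘ c) s =
      ∫ s in (0:ℝ)..t, fderiv ℝ φ (c s) (1, b s (evalC hT γ.1 s)) := by
    refine intervalIntegral.integral_congr_ae ?_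
    filter_upwards [hderiv, Measure.ae_ne volume T] with s hs hsT hmem
    rw [uIoc_of_le ht.1] at hmem
    exact hs ⟨hmem.1, lt_of_le_of_ne (hmem.2.trans ht.2) hsT⟩
  have h := hac.integral_deriv_eq_sub
  rw [hint] at h
  simp only [Function.comp_apply, hc] at h
  rw [h]; ring

lemma deriv_add_fderiv_eq_fderiv_prod {φ : ℝ × E → ℝ} {s : ℝ} {x : E}
    (hφ : DifferentiableAt ℝ φ (s, x)) (v : E) :
    deriv (fun τ => φ (τ, x)) s + fderiv ℝ (fun y => φ (s, y)) x v = fderiv ℝ φ (s, x) (1, v) := by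
  have h1 : HasDerivAt (fun τ => φ (τ, x)) (fderiv ℝ φ (s, x) (1, 0)) s :=
    hφ.hasFDerivAt.comp_hasDerivAt s ((hasDerivAt_id s).prodMk (hasDerivAt_const s x))
  have h2 : HasFDerivAt (fun y => φ (s, y))
      ((fderiv ℝ φ (s, x)).comp (ContinuousLinearMap.inr ℝ ℝ E)) x :=
    hφ.hasFDerivAt.comp x (hasFDerivAt_prodMk_right s x)
  rw [h1.deriv, h2.fderiv, ContinuousLinearMap.comp_apply, ← map_add]
  simp

lemma fderiv_eq_zero_of_vanishing {φ : ℝ × E → ℝ} (hφ : ContDiff ℝ 1 φ) {T R : ℝ} (hT : 0 < T)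
    (hR : ∀ t ∈ Icc (0:ℝ) T, ∀ x : E, R ≤ ‖x‖ → φ (t, x) = 0) {s : ℝ} (hs : s ∈ Icc 0 T)
    {x : E} (hx : R < ‖x‖) : fderiv ℝ φ (s, x) = 0 := by
  have hcont : Continuous fun s => fderiv ℝ φ (s, x) :=
    (hφ.continuous_fderiv one_ne_zero).comp (by fun_prop)
  have heq : EqOn (fun s => fderiv ℝ φ (s, x)) (fun _ => 0) (Ioo 0 T) := by
    intro r hr
    have hnear : φ =ᶠ[nhds (r, x)] fun _ => 0 := by
      have hopen : IsOpen (Ioo 0 T ×ˢ {y : E | R < ‖y‖}) :=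
        isOpen_Ioo.prod (isOpen_lt continuous_const continuous_norm)
      filter_upwards [hopen.mem_nhds ⟨hr, hx⟩] with p hp
      exact hR p.1 (Ioo_subset_Icc_self hp.1) p.2 (le_of_lt hp.2)
    simpa using hnear.fderiv_eq
  have h := heq.closure hcont continuous_const
  rw [closure_Ioo hT.ne] at h
  exact h hs

lemma measurable_uncurry_evalC {X Ω : Type*} [MetricSpace X] [MeasurableSpace X] [BorelSpace X]
    [MeasurableSpace Ω] {T : ℝ} (hT : 0 ≤ T) {M : NNReal} {F : Ω → LipCurve T X M} (hF : Measurable F) :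
    Measurable (Function.uncurry fun t x => evalC hT (F x).1 t) := by
  refine measurable_uncurry_of_continuous_of_measurable (fun x => continuous_evalC hT _) fun t => ?_
  exact (continuous_eval_const (F := Curve T X) (projIcc 0 T hT t)).measurable.comp
    (measurable_subtype_coe.comp hF)

/-- The derivative of a test function along a flow is integrable on `[0,t]` times the space. -/
lemma integrable_fderiv_along_flow [MeasurableSpace E] [BorelSpace E] [FiniteDimensional ℝ E]
    {T : ℝ} (hT : 0 < T) {b : ℝ → E → E} (hb : Measurable (Function.uncurry b)) {M : NNReal}
    (hb_bdd : ∀ t ∈ Icc (0:ℝ) T, ∀ x, ‖b t x‖ ≤ M)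
    (μ₀ : Measure E) [IsLocallyFiniteMeasure μ₀]
    {F : E → LipCurve T E M} (hF : Measurable F) (hF0 : ∀ x, evalC hT.le (F x).1 0 = x)
    {φ : ℝ × E → ℝ} (hφ : ContDiff ℝ 1 φ) {R : ℝ}
    (hR : ∀ t ∈ Icc (0:ℝ) T, ∀ x : E, R ≤ ‖x‖ → φ (t, x) = 0) {t : ℝ} (ht : t ∈ Icc 0 T) :
    Integrable (Function.uncurry fun s x => fderiv ℝ φ (s, evalC hT.le (F x).1 s)
      (1, b s (evalC hT.le (F x).1 s))) ((volume.restrict (uIoc 0 t)).prod μ₀) := by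
  have := FiniteDimensional.proper ℝ E
  have hX := measurable_uncurry_evalC hT.le hF
  have hmeas : Measurable (Function.uncurry fun s x => fderiv ℝ φ (s, evalC hT.le (F x).1 s)
      (1, b s (evalC hT.le (F x).1 s))) := by
    have hpt : Measurable fun p : ℝ × E => (p.1, evalC hT.le (F p.2).1 p.1) :=
      measurable_fst.prodMk hX
    have h1 : Measurable fun p : ℝ × E =>
        ((p.1, evalC hT.le (F p.2).1 p.1), ((1 : ℝ), b p.1 (evalC hT.le (F p.2).1 p.1))) :=
      hpt.prodMk (measurable_const.prodMk (hb.comp hpt))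
    have h2 : Continuous fun q : (ℝ × E) × (ℝ × E) => fderiv ℝ φ q.1 q.2 :=
      ((hφ.continuous_fderiv one_ne_zero).comp continuous_fst).clm_apply continuous_snd
    exact h2.measurable.comp h1
  obtain ⟨C, hC⟩ := (isCompact_Icc.prod (isCompact_closedBall (0 : E) R)).exists_bound_of_continuousOn
    (s := Icc 0 T ×ˢ closedBall (0 : E) R) (hφ.continuous_fderiv one_ne_zero).continuousOn
  have hdist (s : ℝ) (x : E) : ‖x‖ - M * T ≤ ‖evalC hT.le (F x).1 s‖ := by
    have h := dist_evalC_zero_le hT.le (F x) s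
    rw [hF0, dist_comm, dist_eq_norm] at h
    linarith [norm_sub_norm_le x (evalC hT.le (F x).1 s)]
  set S : Set (ℝ × E) := univ ×ˢ closedBall 0 (R + M * T) with hS
  have hS_meas : MeasurableSet S := MeasurableSet.univ.prod measurableSet_closedBall
  have hS_fin : ((volume.restrict (uIoc 0 t)).prod μ₀) S ≠ ⊤ := by
    rw [hS, Measure.prod_prod]
    refine ENNReal.mul_ne_top ?_ measure_closedBall_lt_top.ne
    rw [Measure.restrict_apply_univ, uIoc_of_le ht.1]
    exact measure_Ioc_lt_top.ne
  have hdom : Integrable (S.indicator fun _ => |C| * max 1 (M : ℝ))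
      ((volume.restrict (uIoc 0 t)).prod μ₀) :=
    (integrable_indicator_iff hS_meas).2 (integrableOn_const hS_fin)
  refine hdom.mono' hmeas.aestronglyMeasurable ?_
  rw [Measure.restrict_prod_eq_prod_univ]
  refine ae_restrict_of_forall_mem (measurableSet_uIoc.prod MeasurableSet.univ) ?_
  rintro ⟨s, x⟩ ⟨hs, -⟩
  have hs' : s ∈ Icc 0 T := by
    rw [uIoc_of_le ht.1] at hs
    exact ⟨hs.1.le, hs.2.trans ht.2⟩
  simp only [Function.uncurry_apply_pair]
  by_cases hfar : R < ‖evalC hT.le (F x).1 s‖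
  · rw [fderiv_eq_zero_of_vanishing hφ hT hR hs' hfar]
    simpa using indicator_nonneg (fun _ _ => by positivity) _
  · have hxS : (s, x) ∈ S := by
      refine ⟨mem_univ _, ?_⟩
      rw [mem_closedBall_zero_iff]
      linarith [hdist s x, not_lt.1 hfar]
    rw [indicator_of_mem hxS]
    have hle := hC (s, evalC hT.le (F x).1 s) ⟨hs', by simpa using hfar⟩
    refine (ContinuousLinearMap.le_opNorm _ _).trans ?_
    refine mul_le_mul (hle.trans (le_abs_self C)) ?_ (norm_nonneg _) (abs_nonneg C)
    rw [Prod.norm_def]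
    exact max_le_max (by simp) (hb_bdd s hs' _)

end FlowLemmas

/-- If `μ̄` is a locally finite nonnegative Borel measure on `ℝ^d` and there is a Borel flow
`F : ℝ^d → Γ` of the bounded Borel vector field `b` (every `F x` is an integral curve of `b`
starting at `x`), then the continuity equation `∂_t μ_t + div (b μ_t) = 0`, `μ_t|_{t=0} = μ̄`,
has a measure-valued solution given by a measurable family of locally finite Borel measures. -/
theorem existence_of_flow_implies_existence_of_mvs
    (d : ℕ) (T : ℝ) (hT : 0 < T)
    (b : ℝ → EuclideanSpace ℝ (Fin d) → EuclideanSpace ℝ (Fin d))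
    (hb_borel : Measurable (Function.uncurry b))
    (M : NNReal) (hb_bdd : ∀ t ∈ Set.Icc (0:ℝ) T, ∀ x, ‖b t x‖ ≤ M)
    (μ₀ : Measure (EuclideanSpace ℝ (Fin d))) [IsLocallyFiniteMeasure μ₀]
    (F : EuclideanSpace ℝ (Fin d) → LipCurve T (EuclideanSpace ℝ (Fin d)) M)
    (hF_borel : Measurable F)
    (hF_flow : ∀ x, IsIntegralCurveOf hT.le b (F x).1 ∧ evalC hT.le (F x).1 0 = x) :
    ∃ μ : ℝ → Measure (EuclideanSpace ℝ (Fin d)),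
      (∀ t ∈ Set.Icc (0:ℝ) T, IsLocallyFiniteMeasure (μ t)) ∧
      IsMeasurableFamily T μ ∧ IsMVSolution T b μ μ₀ := by
  have hX := measurable_uncurry_evalC hT.le hF_borel
  have hXt (t : ℝ) : Measurable fun x => evalC hT.le (F x).1 t := hX.of_uncurry_left
  have hdist (t : ℝ) (x) : dist x (evalC hT.le (F x).1 t) ≤ M * T := by
    have h := dist_evalC_zero_le hT.le (F x) t
    rwa [(hF_flow x).2, dist_comm] at h
  have hball (t r : ℝ) :
      μ₀.map (fun x => evalC hT.le (F x).1 t) (closedBall 0 r) ≤ μ₀ (closedBall 0 (r + M * T)) := by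
    rw [Measure.map_apply (hXt t) measurableSet_closedBall]
    refine measure_mono fun x hx => ?_
    have h := dist_triangle x (evalC hT.le (F x).1 t) 0
    rw [mem_preimage, mem_closedBall] at hx
    rw [mem_closedBall]
    linarith [hdist t x]
  have hmeas (B : Set (EuclideanSpace ℝ (Fin d))) (hB : MeasurableSet B) :
      Measurable fun t => μ₀.map (fun x => evalC hT.le (F x).1 t) B := by
    simp_rw [Measure.map_apply (hXt _) hB]
    exact measurable_measure_prodMk_left (hX hB)
  refine ⟨fun t => μ₀.map fun x => evalC hT.le (F x).1 t, fun t _ => ⟨fun x => ?_⟩,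
    ⟨fun B hB _ => (hmeas B hB).aemeasurable, fun K hK => ?_⟩, fun φ hφ ⟨R, hR0, hR⟩ => ?_⟩
  · refine ⟨closedBall 0 (‖x‖ + 1), ?_, (hball t _).trans_lt measure_closedBall_lt_top⟩
    exact closedBall_mem_nhds_of_mem (by simp)
  · obtain ⟨r, hr⟩ := hK.isBounded.subset_closedBall 0
    refine Measure.integrableOn_of_bounded (M := (μ₀ (closedBall 0 (r + M * T))).toReal)
      measure_Icc_lt_top.ne (hmeas K hK.measurableSet).ennreal_toReal.aestronglyMeasurable
      (Filter.Eventually.of_forall fun t => ?_)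
    rw [Real.norm_of_nonneg ENNReal.toReal_nonneg]
    exact ENNReal.toReal_mono measure_closedBall_lt_top.ne ((measure_mono hr).trans (hball t r))
  · refine ae_restrict_of_forall_mem measurableSet_Icc fun t ht => ?_
    have hint := integrable_fderiv_along_flow hT hb_borel hb_bdd μ₀ hF_borel
      (fun x => (hF_flow x).2) hφ hR ht
    have hφ0 : Integrable (fun x => φ (0, x)) μ₀ := by
      refine Continuous.integrable_of_hasCompactSupport (hφ.continuous.comp (by fun_prop)) ?_
      refine HasCompactSupport.intro (isCompact_closedBall 0 R) fun x hx => ?_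
      rw [mem_closedBall_zero_iff, not_le] at hx
      exact hR 0 (left_mem_Icc.2 hT.le) x hx.le
    have hinner (s : ℝ) : ∫ x, (deriv (fun τ => φ (τ, x)) s
        + fderiv ℝ (fun y => φ (s, y)) x (b s x)) ∂(μ₀.map fun x => evalC hT.le (F x).1 s)
        = ∫ x, fderiv ℝ φ (s, evalC hT.le (F x).1 s) (1, b s (evalC hT.le (F x).1 s)) ∂μ₀ := by
      simp_rw [deriv_add_fderiv_eq_fderiv_prod (hφ.differentiable one_ne_zero _)]
      refine integral_map (hXt s).aemeasurable (Measurable.aestronglyMeasurable ?_)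
      have h2 : Continuous fun q : EuclideanSpace ℝ (Fin d) × EuclideanSpace ℝ (Fin d) =>
          fderiv ℝ φ (s, q.1) (1, q.2) :=
        ((hφ.continuous_fderiv one_ne_zero).comp (by fun_prop)).clm_apply (by fun_prop)
      exact h2.measurable.comp (measurable_id.prodMk hb_borel.of_uncurry_left)
    simp_rw [hinner]
    rw [intervalIntegral_integral_swap hint, integral_map (f := fun x => φ (t, x)) (hXt t).aemeasurable
      (hφ.continuous.comp (Continuous.prodMk_right t)).aestronglyMeasurable, ← integral_add hφ0 ?_]
    · refine integral_congr_ae (Filter.Eventually.of_forall fun x => ?_)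
      have h := (hF_flow x).1.comp_eq_add_integral hb_borel hb_bdd hφ ht
      rwa [(hF_flow x).2] at h
    · simp_rw [intervalIntegral.integral_of_le ht.1]
      rw [uIoc_of_le ht.1] at hint
      exact hint.integral_prod_right

end
end

section
/- Let T > 0, I = [0,T], and let b : I × ℝ^d → ℝ^d be a bounded continuous vector field. Then there exists a Borel function F : ℝ^d → Γ such that for every x ∈ ℝ^d the curve F(x) is an integral curve of b with F(x)(0) = x. -/
open MeasureTheory Set Metric

noncomputable section

/-- A continuous map out of a compact metrizable space has a measurable section over its range:
pull back to the Cantor set and select the least point of each fibre. -/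
theorem exists_measurable_section_of_compactSpace {Z E : Type*} [MetricSpace Z] [CompactSpace Z]
    [Nonempty Z] [MeasurableSpace Z] [BorelSpace Z] [TopologicalSpace E] [T2Space E]
    [MeasurableSpace E] [OpensMeasurableSpace E] {p : Z → E} (hp : Continuous p) :
    ∃ s : E → Z, Measurable s ∧ ∀ x ∈ range p, p (s x) = x := by
  classical
  obtain ⟨φ, hφ, hφs⟩ := exists_nat_bool_continuous_surjective_of_compact Z
  set ψ : cantorSet → Z := φ ∘ cantorSetHomeomorphNatToBool
  have hψ : Continuous ψ := hφ.comp cantorSetHomeomorphNatToBool.continuous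
  have hψs : Function.Surjective ψ := hφs.comp cantorSetHomeomorphNatToBool.surjective
  have : CompactSpace cantorSet := isCompact_iff_compactSpace.1 isCompact_cantorSet
  have hq : Continuous (p ∘ ψ) := hp.comp hψ
  have hleast : ∀ x, ∃ c : cantorSet,
      (x ∈ range p → p (ψ c) = x ∧ ∀ c', p (ψ c') = x → c ≤ c') ∧
      (x ∉ range p → c = ⟨0, zero_mem_cantorSet⟩) := by
    intro x
    by_cases hx : x ∈ range p
    · have hne : ((p ∘ ψ) ⁻¹' {x}).Nonempty := by
        obtain ⟨z, rfl⟩ := hx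
        obtain ⟨c, rfl⟩ := hψs z
        exact ⟨c, rfl⟩
      obtain ⟨c, hc, hmin⟩ := (isClosed_singleton.preimage hq).isCompact.exists_isLeast hne
      exact ⟨c, fun _ => ⟨hc, fun c' hc' => hmin hc'⟩, fun h => absurd hx h⟩
    · exact ⟨_, fun h => absurd h hx, fun _ => rfl⟩
  choose r hr hr' using hleast
  have hrm : Measurable fun x => (r x : ℝ) := by
    refine measurable_of_Iic fun a => ?_
    have hEq : (fun x => (r x : ℝ)) ⁻¹' Iic a =
        (p ∘ ψ) '' {c | (c : ℝ) ≤ a} ∪ ((range p)ᶜ ∩ {_x | (0 : ℝ) ≤ a}) := by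
      ext x
      simp only [mem_preimage, mem_Iic, mem_union, mem_image, mem_inter_iff, mem_compl_iff,
        mem_ofPred_eq, Function.comp_apply]
      by_cases hx : x ∈ range p
      · obtain ⟨h1, h2⟩ := hr x hx
        simp only [hx, not_true_eq_false, false_and, or_false]
        exact ⟨fun h => ⟨r x, h, h1⟩, fun ⟨c, hc, hcx⟩ => le_trans (h2 c hcx) hc⟩
      · rw [hr' x hx]
        simp only [hx, not_false_eq_true, true_and]
        exact ⟨Or.inr, fun h => h.resolve_left fun ⟨c, _, hc⟩ => hx ⟨_, hc⟩⟩
    rw [hEq]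
    refine MeasurableSet.union ?_ ((isCompact_range hp).measurableSet.compl.inter (.const _))
    exact ((isClosed_le continuous_subtype_val continuous_const).isCompact.image hq).measurableSet
  have hrm' : Measurable r := hrm.subtype_mk
  exact ⟨ψ ∘ r, hψ.measurable.comp hrm', fun x hx => (hr x hx).1⟩

/-- A continuous surjection from a σ-compact metrizable space onto a Hausdorff space has a
measurable section. -/
theorem exists_measurable_section_of_sigmaCompactSpace {Z E : Type*} [MetricSpace Z]
    [SigmaCompactSpace Z] [MeasurableSpace Z] [BorelSpace Z] [TopologicalSpace E] [T2Space E]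
    [MeasurableSpace E] [OpensMeasurableSpace E] {p : Z → E} (hp : Continuous p)
    (hps : Function.Surjective p) :
    ∃ s : E → Z, Measurable s ∧ ∀ x, p (s x) = x := by
  classical
  rcases isEmpty_or_nonempty Z with hZ | ⟨⟨z₀⟩⟩
  · have : IsEmpty E := ⟨fun x => (hps x).elim fun z _ => hZ.false z⟩
    exact ⟨isEmptyElim, measurable_of_empty _, isEmptyElim⟩
  have hs : ∀ n, ∃ s : E → Z, Measurable s ∧ ∀ x ∈ p '' compactCovering Z n, p (s x) = x := by
    intro n
    rcases (compactCovering Z n).eq_empty_or_nonempty with h | h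
    · exact ⟨fun _ => z₀, measurable_const, by simp [h]⟩
    · have := h.to_subtype
      have := isCompact_iff_compactSpace.1 (isCompact_compactCovering Z n)
      obtain ⟨s, hsm, hs⟩ := exists_measurable_section_of_compactSpace
        (hp.comp (continuous_subtype_val (p := (· ∈ compactCovering Z n))))
      refine ⟨fun x => s x, measurable_subtype_coe.comp hsm, ?_⟩
      rintro x ⟨z, hz, rfl⟩
      exact hs _ ⟨⟨z, hz⟩, rfl⟩
  choose s hsm hs using hs
  have hcov : ∀ x, ∃ n, x ∈ p '' compactCovering Z n := by
    intro x
    obtain ⟨z, rfl⟩ := hps x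
    obtain ⟨n, hn⟩ := exists_mem_compactCovering z
    exact ⟨n, z, hn, rfl⟩
  exact ⟨fun x => s (Nat.find (hcov x)) x, Measurable.find hsm
    (fun n => ((isCompact_compactCovering Z n).image hp).measurableSet) hcov,
    fun x => hs _ _ (Nat.find_spec (hcov x))⟩

theorem continuous_evalC_s3 {T : ℝ} {E : Type*} [MetricSpace E] (hT : 0 ≤ T) :
    Continuous fun q : Curve T E × ℝ => evalC hT q.1 q.2 := by
  unfold evalC
  exact continuous_eval.comp (continuous_fst.prodMk ((continuous_projIcc (h := hT)).comp continuous_snd))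

/-- By Arzelà–Ascoli, the `M`-Lipschitz curves starting in a closed ball of a proper space form a
compact set. -/
theorem isCompact_lipCurve {T : ℝ} {E : Type*} [MetricSpace E] [ProperSpace E]
    (hT : 0 ≤ T) (M : NNReal) (x : E) (R : ℝ) :
    IsCompact {γ : LipCurve T E M | evalC hT γ.1 0 ∈ closedBall x R} := by
  rw [Subtype.isCompact_iff]
  refine ArzelaAscoli.isCompact_of_equicontinuous _ ?_ ?_
  · have hEq : ContinuousMap.toFun '' (Subtype.val ''
        {γ : LipCurve T E M | evalC hT γ.1 0 ∈ closedBall x R}) =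
        {f | LipschitzWith M f} ∩ {f | f (projIcc 0 T hT 0) ∈ closedBall x R} := by
      ext f
      constructor
      · rintro ⟨_, ⟨γ, hγ, rfl⟩, rfl⟩
        exact ⟨γ.2, hγ⟩
      · rintro ⟨h1, h2⟩
        exact ⟨⟨f, h1.continuous⟩, ⟨⟨⟨f, h1.continuous⟩, h1⟩, h2, rfl⟩, rfl⟩
    rw [hEq]
    refine (isCompact_univ_pi fun _ => isCompact_closedBall x (M * T + R)).of_isClosed_subset
      ((isClosed_setOfPred_lipschitzWith M).inter
        (isClosed_closedBall.preimage (continuous_apply _))) ?_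
    rintro f ⟨hf, hf0⟩ t -
    have h1 := hf.dist_le_mul t (projIcc 0 T hT 0)
    have h2 : dist t (projIcc 0 T hT 0) ≤ T := by
      rw [projIcc_left, Subtype.dist_eq, Real.dist_eq, sub_zero, abs_of_nonneg t.2.1]
      exact t.2.2
    calc dist (f t) x ≤ dist (f t) (f (projIcc 0 T hT 0)) + dist (f (projIcc 0 T hT 0)) x :=
          dist_triangle _ _ _
      _ ≤ M * T + R := add_le_add (h1.trans (by gcongr)) hf0
  · refine (LipschitzWith.uniformEquicontinuous _ M ?_).equicontinuous
    rintro ⟨_, γ, _, rfl⟩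
    exact γ.2

theorem sigmaCompactSpace_lipCurve {T : ℝ} {E : Type*} [MetricSpace E] [ProperSpace E]
    (hT : 0 ≤ T) (M : NNReal) : SigmaCompactSpace (LipCurve T E M) := by
  rcases isEmpty_or_nonempty E with h | ⟨⟨x⟩⟩
  · have : IsEmpty (LipCurve T E M) := ⟨fun γ => h.false (evalC hT γ.1 0)⟩
    infer_instance
  refine ⟨⟨fun n => {γ | evalC hT γ.1 0 ∈ closedBall x n},
    fun n => isCompact_lipCurve hT M x n, eq_univ_of_forall fun γ => ?_⟩⟩
  obtain ⟨n, hn⟩ := exists_nat_ge (dist (evalC hT γ.1 0) x)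
  exact mem_iUnion.2 ⟨n, hn⟩

theorem continuous_delayed_integrand {T : ℝ} {E : Type*} [NormedAddCommGroup E]
    {b : ℝ → E → E} (hT : 0 ≤ T) (hb : Continuous (Function.uncurry b)) (δ : ℝ) (γ : Curve T E) :
    Continuous fun s => b s (evalC hT γ (s - δ)) :=
  hb.comp (continuous_id.prodMk ((continuous_evalC_s3 hT).comp
    (continuous_const.prodMk (continuous_id.sub continuous_const))))

section Peano

variable {T : ℝ} {E : Type*} [NormedAddCommGroup E] [NormedSpace ℝ E]

/-- `γ` solves the delay equation `γ(t) = γ(0) + ∫₀ᵗ b(s, γ(s - δ)) ds` on `[0,T]`, where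
`γ = γ(0)` at negative times. -/
def IsDelayedIntegralCurveOf (hT : 0 ≤ T) (b : ℝ → E → E) (δ : ℝ) (γ : Curve T E) : Prop :=
  ∀ t ∈ Icc (0 : ℝ) T,
    evalC hT γ t = evalC hT γ 0 + ∫ s in (0 : ℝ)..t, b s (evalC hT γ (s - δ))

theorem isDelayedIntegralCurveOf_zero {hT : 0 ≤ T} {b : ℝ → E → E} {γ : Curve T E} :
    IsDelayedIntegralCurveOf hT b 0 γ ↔ IsIntegralCurveOf hT b γ := by
  simp [IsDelayedIntegralCurveOf, IsIntegralCurveOf]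

variable {b : ℝ → E → E}

theorem isClosed_setOf_isDelayedIntegralCurveOf (hT : 0 ≤ T)
    (hb : Continuous (Function.uncurry b)) :
    IsClosed {q : ℝ × Curve T E | IsDelayedIntegralCurveOf hT b q.1 q.2} := by
  have hev : ∀ t, Continuous fun q : ℝ × Curve T E => evalC hT q.2 t := fun t =>
    (continuous_evalC_s3 hT).comp (continuous_snd.prodMk continuous_const)
  have hint : ∀ t, Continuous fun q : ℝ × Curve T E =>
      ∫ s in (0 : ℝ)..t, b s (evalC hT q.2 (s - q.1)) := by
    intro t
    refine intervalIntegral.continuous_parametric_intervalIntegral_of_continuous' ?_ 0 t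
    exact hb.comp (continuous_snd.prodMk ((continuous_evalC_s3 hT).comp
      ((continuous_snd.comp continuous_fst).prodMk
        (continuous_snd.sub (continuous_fst.comp continuous_fst)))))
  simp only [IsDelayedIntegralCurveOf, ofPred_forall]
  exact isClosed_biInter fun t _ => isClosed_eq (hev t) ((hev 0).add (hint t))

/-- The operator whose fixed points are the solutions of the delay equation starting at `x`. -/
def delayedPicard (hT : 0 ≤ T) (hb : Continuous (Function.uncurry b)) (δ : ℝ) (x : E)
    (γ : Curve T E) : Curve T E where
  toFun t := x + ∫ s in (0 : ℝ)..t, b s (evalC hT γ (s - δ))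
  continuous_toFun := continuous_const.add <|
    (intervalIntegral.continuous_primitive
      (fun _ _ => (continuous_delayed_integrand hT hb δ γ).intervalIntegrable _ _) 0).comp
      continuous_subtype_val

theorem lipschitzWith_delayedPicard (hT : 0 ≤ T) (hb : Continuous (Function.uncurry b))
    {M : NNReal} (hM : ∀ t ∈ Icc (0 : ℝ) T, ∀ x, ‖b t x‖ ≤ M) (δ : ℝ) (x : E) (γ : Curve T E) :
    LipschitzWith M (delayedPicard hT hb δ x γ) := by
  refine LipschitzWith.of_dist_le_mul fun t t' => ?_
  have hi := (continuous_delayed_integrand hT hb δ γ).intervalIntegrable (μ := volume)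
  change dist (x + _) (x + _) ≤ _
  rw [dist_add_left, dist_eq_norm, intervalIntegral.integral_interval_sub_left (hi _ _) (hi _ _),
    Subtype.dist_eq, Real.dist_eq]
  refine intervalIntegral.norm_integral_le_of_norm_le_const fun s hs => hM s ?_ _
  exact uIcc_subset_Icc t'.2 t.2 (uIoc_subset_uIcc hs)

theorem exists_isDelayedIntegralCurveOf (hT : 0 ≤ T) (hb : Continuous (Function.uncurry b))
    {M : NNReal} (hM : ∀ t ∈ Icc (0 : ℝ) T, ∀ x, ‖b t x‖ ≤ M) {δ : ℝ} (hδ : 0 < δ) (x : E) :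
    ∃ γ : LipCurve T E M, evalC hT γ.1 0 = x ∧ IsDelayedIntegralCurveOf hT b δ γ.1 := by
  set Φ := delayedPicard hT hb δ x
  set u : ℕ → Curve T E := fun n => Φ^[n] (ContinuousMap.const _ x) with hu
  have hΦ_apply : ∀ γ s, evalC hT (Φ γ) s =
      x + ∫ σ in (0 : ℝ)..projIcc 0 T hT s, b σ (evalC hT γ (σ - δ)) := fun _ _ => rfl
  have hsucc : ∀ n, u (n + 1) = Φ (u n) := fun n => Function.iterate_succ_apply' _ _ _
  have hstab : ∀ n : ℕ, ∀ s ≤ n * δ, evalC hT (u (n + 1)) s = evalC hT (u n) s := by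
    intro n
    induction n with
    | zero =>
      intro s hs
      rw [hsucc, hΦ_apply, projIcc_of_le_left hT (by simpa using hs)]
      simp [hu, evalC]
    | succ n ih =>
      intro s hs
      rw [hsucc (n + 1), hΦ_apply, hsucc n, hΦ_apply]
      congr 1
      refine intervalIntegral.integral_congr fun σ hσ => ?_
      rw [uIcc_of_le (projIcc 0 T hT s).2.1, coe_projIcc] at hσ
      have hσ' : σ ≤ max 0 s := hσ.2.trans (max_le_max le_rfl (min_le_right _ _))
      have hσn : σ ≤ (n + 1 : ℕ) * δ := hσ'.trans (max_le (by positivity) hs)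
      push_cast at hσn
      change b σ _ = b σ _
      rw [← hsucc n, ih (σ - δ) (by linarith)]
  obtain ⟨N, hN⟩ := exists_nat_ge (T / δ)
  have hfix : Φ (u N) = u N := by
    ext1 t
    have := hstab N t (t.2.2.trans ((div_le_iff₀ hδ).1 hN))
    rwa [hsucc, evalC, evalC, projIcc_val] at this
  have h0 : evalC hT (u N) 0 = x := by
    rw [← hfix, hΦ_apply, projIcc_left]
    simp
  refine ⟨⟨u N, hfix ▸ lipschitzWith_delayedPicard hT hb hM δ x (u N)⟩, h0, fun t ht => ?_⟩
  change evalC hT (u N) t = evalC hT (u N) 0 + _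
  rw [h0]
  conv_lhs => rw [← hfix, hΦ_apply, projIcc_of_mem hT ht]

/-- **Peano's theorem** for bounded continuous vector fields, by letting the delay go to zero. -/
theorem exists_isIntegralCurveOf [ProperSpace E] (hT : 0 ≤ T)
    (hb : Continuous (Function.uncurry b)) {M : NNReal}
    (hM : ∀ t ∈ Icc (0 : ℝ) T, ∀ x, ‖b t x‖ ≤ M) (x : E) :
    ∃ γ : LipCurve T E M, evalC hT γ.1 0 = x ∧ IsIntegralCurveOf hT b γ.1 := by
  have hcomp : IsCompact ((Icc (0 : ℝ) 1 ×ˢ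
      {γ : LipCurve T E M | evalC hT γ.1 0 ∈ closedBall x 0}) ∩
      {q | IsDelayedIntegralCurveOf hT b q.1 q.2.1}) :=
    (isCompact_Icc.prod (isCompact_lipCurve hT M x 0)).inter_right
      ((isClosed_setOf_isDelayedIntegralCurveOf hT hb).preimage
        (continuous_fst.prodMk (continuous_subtype_val.comp continuous_snd)))
  have hsub : Ioc (0 : ℝ) 1 ⊆ Prod.fst '' ((Icc (0 : ℝ) 1 ×ˢ
      {γ : LipCurve T E M | evalC hT γ.1 0 ∈ closedBall x 0}) ∩
      {q | IsDelayedIntegralCurveOf hT b q.1 q.2.1}) := by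
    intro δ hδ
    obtain ⟨γ, hγ0, hγ⟩ := exists_isDelayedIntegralCurveOf hT hb hM hδ.1 x
    exact ⟨(δ, γ), ⟨⟨Ioc_subset_Icc_self hδ, by simp [hγ0]⟩, hγ⟩, rfl⟩
  have h0 : (0 : ℝ) ∈ closure (Ioc (0 : ℝ) 1) := by
    rw [closure_Ioc zero_ne_one]
    exact left_mem_Icc.2 zero_le_one
  obtain ⟨⟨_, γ⟩, ⟨⟨-, hγ0⟩, hγ⟩, rfl⟩ :=
    closure_minimal hsub (hcomp.image continuous_fst).isClosed h0
  exact ⟨γ, by simpa using hγ0, isDelayedIntegralCurveOf_zero.1 hγ⟩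

end Peano

/-- (Zubelevich) If `b` is a bounded continuous vector field on `[0,T] × ℝ^d`, then there is a
Borel function `F : ℝ^d → Γ` such that for every `x` the curve `F x` is an integral curve of
`b` with `F x 0 = x`. -/
theorem existence_of_borel_flow_continuous
    (d : ℕ) (T : ℝ) (hT : 0 < T)
    (b : ℝ → EuclideanSpace ℝ (Fin d) → EuclideanSpace ℝ (Fin d))
    (hb_cont : Continuous (Function.uncurry b))
    (M : NNReal) (hb_bdd : ∀ t ∈ Set.Icc (0:ℝ) T, ∀ x, ‖b t x‖ ≤ M) :
    ∃ F : EuclideanSpace ℝ (Fin d) → LipCurve T (EuclideanSpace ℝ (Fin d)) M,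
      Measurable F ∧
      ∀ x, IsIntegralCurveOf hT.le b (F x).1 ∧ evalC hT.le (F x).1 0 = x := by
  have := sigmaCompactSpace_lipCurve (E := EuclideanSpace ℝ (Fin d)) hT.le M
  have hclosed : IsClosed {γ : LipCurve T (EuclideanSpace ℝ (Fin d)) M |
      IsIntegralCurveOf hT.le b γ.1} := by
    simp only [← isDelayedIntegralCurveOf_zero]
    exact (isClosed_setOf_isDelayedIntegralCurveOf hT.le hb_cont).preimage
      (continuous_const.prodMk continuous_subtype_val)
  have := hclosed.isClosedEmbedding_subtypeVal.sigmaCompactSpace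
  have hp : Continuous fun γ : {γ : LipCurve T (EuclideanSpace ℝ (Fin d)) M |
      IsIntegralCurveOf hT.le b γ.1} => evalC hT.le γ.1.1 0 :=
    (continuous_evalC_s3 hT.le).comp
      ((continuous_subtype_val.comp continuous_subtype_val).prodMk continuous_const)
  obtain ⟨s, hsm, hs⟩ := exists_measurable_section_of_sigmaCompactSpace hp fun x => by
    obtain ⟨γ, hγ0, hγ⟩ := exists_isIntegralCurveOf hT.le hb_cont hb_bdd x
    exact ⟨⟨γ, hγ⟩, hγ0⟩
  exact ⟨fun x => (s x).1, measurable_subtype_coe.comp hsm, fun x => ⟨(s x).2, hs x⟩⟩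

end
end

section
/- Define b : ℝ → ℝ by b(x) = −1 for x ≥ 0 and b(x) = 1 for x < 0, and let u : ℝ → ℝ be u = 1_{(0,+∞)} − 1_{(−∞,0)}. Then the signed measure b u 𝓛¹ has zero distributional divergence: for every φ ∈ C¹(ℝ) with compact support, ∫_ℝ b(x) u(x) φ'(x) dx = 0. Consequently the time-independent family μ_t := u 𝓛¹ is a signed measure-valued solution of ∂_t μ_t + div(b μ_t) = 0 with initial data u 𝓛¹. -/
open MeasureTheory Set Metric

noncomputable section

/-- The vector field `b(x) = -1` for `x ≥ 0` and `b(x) = 1` for `x < 0`. -/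
def bEx (x : ℝ) : ℝ := if 0 ≤ x then -1 else 1

/-- `u = 1_{(0,+∞)} - 1_{(-∞,0)}`. -/
def uEx (x : ℝ) : ℝ :=
  Set.indicator (Set.Ioi (0:ℝ)) 1 x - Set.indicator (Set.Iio (0:ℝ)) 1 x

lemma bEx_mul_uEx_ae : ∀ᵐ x : ℝ, bEx x * uEx x = -1 := by
  filter_upwards [Measure.ae_ne volume (0 : ℝ)] with x hx
  rcases hx.lt_or_gt with h | h
  · simp [bEx, uEx, h, h.le, not_le.2 h]
  · simp [bEx, uEx, h, h.le, not_lt.2 h.le]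

lemma measurable_uEx : Measurable uEx :=
  (measurable_one.indicator measurableSet_Ioi).sub (measurable_one.indicator measurableSet_Iio)

lemma norm_uEx_le (x : ℝ) : ‖uEx x‖ ≤ 1 := by
  rcases lt_trichotomy x 0 with h | h | h
  · simp [uEx, h, h.le]
  · simp [uEx, h]
  · simp [uEx, h, h.le]

lemma integral_bEx_mul_uEx_mul_deriv (φ : ℝ → ℝ) (hφ : ContDiff ℝ 1 φ)
    (hc : HasCompactSupport φ) : ∫ x, bEx x * uEx x * deriv φ x = 0 := by
  have h : ∫ x, bEx x * uEx x * deriv φ x = ∫ x, -deriv φ x := by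
    refine integral_congr_ae ?_
    filter_upwards [bEx_mul_uEx_ae] with x hx
    rw [hx, neg_one_mul]
  rw [h, integral_neg, integral_eq_zero_of_hasDerivAt_of_integrable
    (fun x => (hφ.differentiable one_ne_zero x).hasDerivAt)
    ((hφ.continuous_deriv le_rfl).integrable_of_hasCompactSupport hc.deriv)
    (hφ.continuous.integrable_of_hasCompactSupport hc), neg_zero]

lemma hasDerivAt_slice_fst {φ : ℝ × ℝ → ℝ} (hφ : ContDiff ℝ 1 φ) (s x : ℝ) :
    HasDerivAt (fun τ => φ (τ, x)) (fderiv ℝ φ (s, x) (1, 0)) s :=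
  (hφ.differentiable one_ne_zero (s, x)).hasFDerivAt.comp_hasDerivAt s
    ((hasDerivAt_id s).prodMk (hasDerivAt_const s x))

lemma continuous_deriv_slice_fst {φ : ℝ × ℝ → ℝ} (hφ : ContDiff ℝ 1 φ) :
    Continuous fun p : ℝ × ℝ => deriv (fun τ => φ (τ, p.2)) p.1 := by
  have h : (fun p : ℝ × ℝ => deriv (fun τ => φ (τ, p.2)) p.1) =
      fun p => fderiv ℝ φ p (1, 0) := funext fun p => (hasDerivAt_slice_fst hφ p.1 p.2).deriv
  rw [h]
  exact (hφ.continuous_fderiv one_ne_zero).clm_apply continuous_const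

lemma deriv_slice_fst_eq_zero {φ : ℝ × ℝ → ℝ} (hφ : ContDiff ℝ 1 φ) {T : ℝ} (hT : 0 < T) {x : ℝ}
    (hx : ∀ t ∈ Icc 0 T, φ (t, x) = 0) {s : ℝ} (hs : s ∈ Icc 0 T) :
    deriv (fun τ => φ (τ, x)) s = 0 := by
  have h :=
    (hasDerivAt_slice_fst hφ s x).differentiableAt.hasDerivAt.hasDerivWithinAt (s := Icc 0 T)
  exact (uniqueDiffOn_Icc hT s hs).eq_deriv _ h
    ((hasDerivWithinAt_const s (Icc 0 T) (0 : ℝ)).congr hx (hx s hs))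

lemma integrableOn_mul_uEx {f : ℝ → ℝ} (hf : Continuous f) (R : ℝ) :
    IntegrableOn (fun x => f x * uEx x) (closedBall 0 R) :=
  (hf.continuousOn.integrableOn_compact (isCompact_closedBall 0 R)).mul_bdd (c := 1)
    measurable_uEx.aestronglyMeasurable (Filter.Eventually.of_forall norm_uEx_le)

/-- A function vanishing outside a ball has the same integral against `u` over the ball
and over the whole line. -/
lemma setIntegral_mul_uEx {f : ℝ → ℝ} {R : ℝ} (hf : ∀ x, R ≤ ‖x‖ → f x = 0) :
    ∫ x in closedBall 0 R, f x * uEx x = ∫ x, f x * uEx x := by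
  refine setIntegral_eq_integral_of_forall_compl_eq_zero fun x hx => ?_
  rw [hf x (not_le.1 (mt mem_closedBall_zero_iff.2 hx)).le, zero_mul]

lemma hasCompactSupport_of_eq_zero {f : ℝ → ℝ} {R : ℝ} (hf : ∀ x, R ≤ ‖x‖ → f x = 0) :
    HasCompactSupport f :=
  HasCompactSupport.intro (isCompact_closedBall 0 R) fun x hx =>
    hf x (not_le.1 (mt mem_closedBall_zero_iff.2 hx)).le

lemma integral_transport_mul_uEx {φ : ℝ × ℝ → ℝ} (hφ : ContDiff ℝ 1 φ) {T : ℝ} (hT : 0 < T) {R : ℝ}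
    (hR : ∀ t ∈ Icc 0 T, ∀ x : ℝ, R ≤ ‖x‖ → φ (t, x) = 0) {s : ℝ} (hs : s ∈ Icc 0 T) :
    ∫ x, (deriv (fun τ => φ (τ, x)) s + bEx x * deriv (fun y => φ (s, y)) x) * uEx x =
      ∫ x in closedBall 0 R, deriv (fun τ => φ (τ, x)) s * uEx x := by
  have hzero : ∀ x, R ≤ ‖x‖ → deriv (fun τ => φ (τ, x)) s = 0 := fun x hx =>
    deriv_slice_fst_eq_zero hφ hT (fun t ht => hR t ht x hx) hs
  have hcont : Continuous fun x => deriv (fun τ => φ (τ, x)) s :=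
    (continuous_deriv_slice_fst hφ).comp (Continuous.prodMk_right s)
  have hslice : ContDiff ℝ 1 fun y => φ (s, y) := hφ.comp (contDiff_prodMk_right s)
  have hsupp : HasCompactSupport fun y => φ (s, y) := hasCompactSupport_of_eq_zero (hR s hs)
  have h_int : Integrable fun x => deriv (fun τ => φ (τ, x)) s * uEx x :=
    (hcont.integrable_of_hasCompactSupport (hasCompactSupport_of_eq_zero hzero)).mul_bdd (c := 1)
      measurable_uEx.aestronglyMeasurable (Filter.Eventually.of_forall norm_uEx_le)
  have h_int' : Integrable fun x => bEx x * uEx x * deriv (fun y => φ (s, y)) x := by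
    refine ((hslice.continuous_deriv le_rfl).integrable_of_hasCompactSupport hsupp.deriv).neg.congr ?_
    filter_upwards [bEx_mul_uEx_ae] with x hx
    simp [hx]
  rw [setIntegral_mul_uEx hzero, ← add_zero (∫ x, deriv (fun τ => φ (τ, x)) s * uEx x),
    ← integral_bEx_mul_uEx_mul_deriv _ hslice hsupp, ← integral_add h_int h_int']
  exact integral_congr_ae (Filter.Eventually.of_forall fun x => by ring)

lemma integral_setIntegral_deriv_mul_uEx {φ : ℝ × ℝ → ℝ} (hφ : ContDiff ℝ 1 φ) {t : ℝ}
    (ht : 0 ≤ t) (R : ℝ) :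
    ∫ s in (0 : ℝ)..t, ∫ x in closedBall 0 R, deriv (fun τ => φ (τ, x)) s * uEx x =
      ∫ x in closedBall 0 R, (φ (t, x) - φ (0, x)) * uEx x := by
  have h_int : Integrable
      (Function.uncurry fun s x => deriv (fun τ => φ (τ, x)) s * uEx x)
      ((volume.restrict (Ioc 0 t)).prod (volume.restrict (closedBall 0 R))) := by
    refine Integrable.mul_bdd (c := 1) ?_
      (measurable_uEx.comp measurable_snd).aestronglyMeasurable
      (Filter.Eventually.of_forall fun p => norm_uEx_le p.2)
    rw [Measure.prod_restrict]
    exact ((continuous_deriv_slice_fst hφ).continuousOn.integrableOn_compact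
      (isCompact_Icc.prod (isCompact_closedBall 0 R))).mono_set
      (prod_mono Ioc_subset_Icc_self Subset.rfl)
  rw [intervalIntegral.integral_of_le ht, integral_integral_swap h_int]
  congr 1 with x
  rw [integral_mul_const, ← intervalIntegral.integral_of_le ht,
    intervalIntegral.integral_deriv_eq_sub
      (fun s _ => (hasDerivAt_slice_fst hφ s x).differentiableAt)
      (((continuous_deriv_slice_fst hφ).comp (Continuous.prodMk_left x)).intervalIntegrable _ _)]

/-- For `b(x) = -1` for `x ≥ 0`, `b(x) = 1` for `x < 0`, and `u = 1_{(0,∞)} - 1_{(-∞,0)}`,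
the signed measure `b u 𝓛¹` has zero distributional divergence: `∫ b u φ' dx = 0` for every
compactly supported `C¹` function `φ`. Consequently, the time-independent family
`μ_t := u 𝓛¹` is a signed measure-valued solution of `∂_t μ_t + div (b μ_t) = 0` with
initial datum `u 𝓛¹`. -/
theorem signed_mvs_for_bEx (T : ℝ) (hT : 0 < T) :
    (∀ φ : ℝ → ℝ, ContDiff ℝ 1 φ → HasCompactSupport φ →
      ∫ x, bEx x * uEx x * deriv φ x = 0) ∧
    (∀ φ : ℝ × ℝ → ℝ, ContDiff ℝ 1 φ →
      (∃ R > (0:ℝ), ∀ t ∈ Set.Icc (0:ℝ) T, ∀ x : ℝ, R ≤ ‖x‖ → φ (t, x) = 0) →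
      ∀ᵐ t ∂(volume.restrict (Set.Icc (0:ℝ) T)),
        ∫ x, φ (t, x) * uEx x =
          (∫ x, φ (0, x) * uEx x) +
            ∫ s in (0:ℝ)..t, (∫ x, (deriv (fun τ => φ (τ, x)) s
              + bEx x * deriv (fun y => φ (s, y)) x) * uEx x)) := by
  refine ⟨integral_bEx_mul_uEx_mul_deriv, fun φ hφ ⟨R, _, hR⟩ => ?_⟩
  filter_upwards [ae_restrict_mem measurableSet_Icc] with t ht
  have h0 : (0 : ℝ) ∈ Icc 0 T := left_mem_Icc.2 hT.le
  have hslice : ∀ s, Continuous fun x => φ (s, x) := fun s =>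
    hφ.continuous.comp (Continuous.prodMk_right s)
  rw [intervalIntegral.integral_congr fun s hs => integral_transport_mul_uEx hφ hT hR
      ((uIcc_subset_Icc h0 ht) hs), integral_setIntegral_deriv_mul_uEx hφ ht.1 R,
    ← setIntegral_mul_uEx (hR t ht), ← setIntegral_mul_uEx (hR 0 h0)]
  simp_rw [sub_mul]
  rw [integral_sub (integrableOn_mul_uEx (hslice t) R) (integrableOn_mul_uEx (hslice 0) R)]
  ring

end
end

section
/- Let T > 0, I = [0,T], and define b̃ : ℝ → ℝ by b̃ = 1_{(−∞,0)} − 1_{(0,+∞)} (so b̃(0) = 0), viewed as an autonomous bounded Borel vector field on I × ℝ. Then there exists a Borel function F : ℝ → Γ such that for every x ∈ ℝ the curve F(x) is an integral curve of b̃ with F(x)(0) = x; explicitly, F(x)(t) = sign(x)·max(|x| − t, 0) is such a flow. Consequently, for every nonnegative locally finite Borel measure μ̄ on ℝ the problem ∂_t μ_t + div(b̃ μ_t) = 0 with initial data μ̄ has a nonnegative measure-valued solution. -/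
open MeasureTheory Set Metric

noncomputable section

/-- The vector field `b̃ = 1_{(-∞,0)} - 1_{(0,+∞)}` (so `b̃ 0 = 0`). -/
def bTilde (x : ℝ) : ℝ :=
  Set.indicator (Set.Iio (0:ℝ)) 1 x - Set.indicator (Set.Ioi (0:ℝ)) 1 x

/-- The flow of `bTilde` for nonnegative times, in the form of soft thresholding. -/
def softThreshold (t x : ℝ) : ℝ := max (x - t) 0 + min (x + t) 0

theorem continuous_softThreshold : Continuous fun p : ℝ × ℝ => softThreshold p.1 p.2 := by
  unfold softThreshold
  fun_prop

theorem softThreshold_zero_left (x : ℝ) : softThreshold 0 x = x := by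
  simp [softThreshold, max_add_min]

theorem softThreshold_of_le {t x : ℝ} (ht : 0 ≤ t) (hx : t ≤ x) : softThreshold t x = x - t := by
  rw [softThreshold, max_eq_left (by linarith), min_eq_right (by linarith), add_zero]

theorem softThreshold_of_le_neg {t x : ℝ} (ht : 0 ≤ t) (hx : x ≤ -t) :
    softThreshold t x = x + t := by
  rw [softThreshold, max_eq_right (by linarith), min_eq_left (by linarith), zero_add]

theorem softThreshold_of_abs_le {t x : ℝ} (hx : |x| ≤ t) : softThreshold t x = 0 := by
  rw [abs_le] at hx
  rw [softThreshold, max_eq_right (by linarith), min_eq_right (by linarith), zero_add]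

theorem softThreshold_eq_sign_mul {t : ℝ} (ht : 0 ≤ t) (x : ℝ) :
    softThreshold t x = Real.sign x * max (|x| - t) 0 := by
  rcases le_total |x| t with h | h
  · rw [softThreshold_of_abs_le h, max_eq_right (by linarith), mul_zero]
  rw [max_eq_left (by linarith)]
  rcases lt_trichotomy x 0 with hx | rfl | hx
  · rw [abs_of_neg hx] at h ⊢
    rw [softThreshold_of_le_neg ht (by linarith), Real.sign_of_neg hx]
    ring
  · rw [abs_zero] at h
    rw [softThreshold_of_abs_le (by simpa using ht)]
    simp
  · rw [abs_of_pos hx] at h ⊢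
    rw [softThreshold_of_le ht h, Real.sign_of_pos hx]
    ring

theorem abs_le_abs_softThreshold_add {t : ℝ} (ht : 0 ≤ t) (x : ℝ) :
    |x| ≤ |softThreshold t x| + t := by
  rcases le_total |x| t with h | h
  · linarith [abs_nonneg (softThreshold t x)]
  rcases le_total 0 x with hx | hx
  · rw [abs_of_nonneg hx] at h ⊢
    rw [softThreshold_of_le ht h]
    linarith [le_abs_self (x - t)]
  · rw [abs_of_nonpos hx] at h ⊢
    rw [softThreshold_of_le_neg ht (by linarith)]
    linarith [neg_abs_le (x + t)]

theorem abs_softThreshold_sub_le {s t : ℝ} (hs : 0 ≤ s) (ht : 0 ≤ t) (x : ℝ) :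
    |softThreshold s x - softThreshold t x| ≤ |s - t| := by
  unfold softThreshold
  rcases max_cases (x - s) 0 with h | h <;> rcases max_cases (x - t) 0 with h' | h' <;>
  rcases min_cases (x + s) 0 with k | k <;> rcases min_cases (x + t) 0 with k' | k' <;>
  rw [h.1, h'.1, k.1, k'.1, abs_le] <;>
  constructor <;> linarith [le_abs_self (s - t), neg_abs_le (s - t)]

theorem measurable_bTilde : Measurable bTilde :=
  (measurable_one.indicator measurableSet_Iio).sub (measurable_one.indicator measurableSet_Ioi)

theorem bTilde_of_pos {x : ℝ} (hx : 0 < x) : bTilde x = -1 := by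
  simp [bTilde, hx, hx.le]

theorem bTilde_of_neg {x : ℝ} (hx : x < 0) : bTilde x = 1 := by
  simp [bTilde, hx, hx.le]

theorem bTilde_zero : bTilde 0 = 0 := by
  simp [bTilde]

theorem norm_bTilde_le (x : ℝ) : ‖bTilde x‖ ≤ 1 := by
  rcases lt_trichotomy x 0 with hx | rfl | hx
  · simp [bTilde_of_neg hx]
  · simp [bTilde_zero]
  · simp [bTilde_of_pos hx]

theorem hasDerivAt_softThreshold {s x : ℝ} (hs : 0 < s) (hne : s ≠ |x|) :
    HasDerivAt (fun τ => softThreshold τ x) (bTilde (softThreshold s x)) s := by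
  rcases lt_or_gt_of_ne hne with h | h
  · rcases le_total 0 x with hx | hx
    · rw [abs_of_nonneg hx] at h
      rw [softThreshold_of_le hs.le h.le, bTilde_of_pos (by linarith)]
      refine ((hasDerivAt_id s).const_sub x).congr_of_eventuallyEq ?_
      filter_upwards [Ioo_mem_nhds hs h] with τ hτ
      exact softThreshold_of_le hτ.1.le hτ.2.le
    · rw [abs_of_nonpos hx] at h
      rw [softThreshold_of_le_neg hs.le (by linarith), bTilde_of_neg (by linarith)]
      refine ((hasDerivAt_id s).const_add x).congr_of_eventuallyEq ?_
      filter_upwards [Ioo_mem_nhds hs h] with τ hτ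
      exact softThreshold_of_le_neg hτ.1.le (by linarith [hτ.2])
  · rw [softThreshold_of_abs_le (le_of_lt h), bTilde_zero]
    refine (hasDerivAt_const s (0 : ℝ)).congr_of_eventuallyEq ?_
    filter_upwards [Ioi_mem_nhds h] with τ hτ
    exact softThreshold_of_abs_le (le_of_lt hτ)

/-- The derivative `∂_t φ + b̃ ∂_x φ` of `φ` along the vector field `bTilde`. -/
def transportDeriv (φ : ℝ × ℝ → ℝ) (s y : ℝ) : ℝ :=
  fderiv ℝ φ (s, y) (1, 0) + bTilde y * fderiv ℝ φ (s, y) (0, 1)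

theorem fderiv_apply_one_bTilde (φ : ℝ × ℝ → ℝ) (s y : ℝ) :
    fderiv ℝ φ (s, y) (1, bTilde y) = transportDeriv φ s y := by
  have : ((1 : ℝ), bTilde y) = (1, 0) + bTilde y • ((0 : ℝ), (1 : ℝ)) := by simp
  rw [this, map_add, map_smul, smul_eq_mul, transportDeriv]

theorem deriv_add_fderiv_eq_transportDeriv {φ : ℝ × ℝ → ℝ} (hφ : Differentiable ℝ φ) (s y : ℝ) :
    deriv (fun τ => φ (τ, y)) s + fderiv ℝ (fun z => φ (s, z)) y (bTilde y) =
      transportDeriv φ s y := by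
  have h := (hφ (s, y)).hasFDerivAt
  have h₁ : HasDerivAt (fun τ => φ (τ, y)) (fderiv ℝ φ (s, y) (1, 0)) s :=
    h.comp_hasDerivAt s ((hasDerivAt_id s).prodMk (hasDerivAt_const s y))
  have h₂ : HasDerivAt (fun z => φ (s, z)) (fderiv ℝ φ (s, y) (0, 1)) y :=
    h.comp_hasDerivAt y ((hasDerivAt_const y s).prodMk (hasDerivAt_id y))
  rw [h₁.deriv, fderiv_eq_smul_deriv, h₂.deriv, smul_eq_mul, transportDeriv]

theorem measurable_transportDeriv {φ : ℝ × ℝ → ℝ} (hφ : ContDiff ℝ 1 φ) (s : ℝ) :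
    Measurable (transportDeriv φ s) := by
  have hc : Continuous (fderiv ℝ φ) := hφ.continuous_fderiv one_ne_zero
  have h₁ : Continuous fun y : ℝ => fderiv ℝ φ (s, y) (1, 0) := by fun_prop
  have h₂ : Continuous fun y : ℝ => fderiv ℝ φ (s, y) (0, 1) := by fun_prop
  exact h₁.measurable.add (measurable_bTilde.mul h₂.measurable)

theorem integral_transportDeriv_softThreshold {φ : ℝ × ℝ → ℝ} (hφ : ContDiff ℝ 1 φ) {t : ℝ}
    (ht : 0 ≤ t) (x : ℝ) :
    ∫ s in (0 : ℝ)..t, transportDeriv φ s (softThreshold s x) =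
      φ (t, softThreshold t x) - φ (0, x) := by
  have hX : Continuous fun s => softThreshold s x :=
    continuous_softThreshold.comp (Continuous.prodMk_left x)
  have hc : Continuous (fderiv ℝ φ) := hφ.continuous_fderiv one_ne_zero
  have h₁ : Continuous fun s => fderiv ℝ φ (s, softThreshold s x) (1, 0) := by fun_prop
  have h₂ : Continuous fun s => fderiv ℝ φ (s, softThreshold s x) (0, 1) := by fun_prop
  have hb : IntervalIntegrable (fun s => bTilde (softThreshold s x)) volume 0 t :=
    (intervalIntegrable_const (c := (1 : ℝ))).mono_fun
      (measurable_bTilde.comp hX.measurable).aestronglyMeasurable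
      (.of_forall fun s => by simpa using norm_bTilde_le (softThreshold s x))
  have hφc := hφ.continuous
  rw [integral_eq_of_hasDerivAt_off_countable_of_le
    (fun s => φ (s, softThreshold s x))
    (fun s => transportDeriv φ s (softThreshold s x)) ht (countable_singleton |x|) (by fun_prop) ?_
    ((h₁.intervalIntegrable _ _).add (hb.mul_continuousOn h₂.continuousOn)),
    softThreshold_zero_left]
  rintro s ⟨hs, hne⟩
  rw [← fderiv_apply_one_bTilde]
  exact (hφ.differentiable one_ne_zero _).hasFDerivAt.comp_hasDerivAt s
    ((hasDerivAt_id s).prodMk (hasDerivAt_softThreshold hs.1 hne))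

theorem integrable_transportDeriv_softThreshold {φ : ℝ × ℝ → ℝ} (hφ : ContDiff ℝ 1 φ) {R T t : ℝ}
    (hR : ∀ s ∈ Icc (0 : ℝ) T, ∀ x : ℝ, R ≤ ‖x‖ → φ (s, x) = 0) (ht : t < T)
    (μ₀ : Measure ℝ) [IsLocallyFiniteMeasure μ₀] :
    Integrable (fun p : ℝ × ℝ => transportDeriv φ p.1 (softThreshold p.1 p.2))
      ((volume.restrict (Ioc 0 t)).prod μ₀) := by
  have hX := continuous_softThreshold
  have hc : Continuous (fderiv ℝ φ) := hφ.continuous_fderiv one_ne_zero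
  have hzero : ∀ s ∈ Ioo (0 : ℝ) T, ∀ y : ℝ, R < ‖y‖ → fderiv ℝ φ (s, y) = 0 := by
    intro s hs y hy
    have : φ =ᶠ[nhds (s, y)] fun _ => 0 := by
      have hopen : IsOpen (Ioo (0 : ℝ) T ×ˢ {y : ℝ | R < ‖y‖}) :=
        isOpen_Ioo.prod (isOpen_lt continuous_const continuous_norm)
      filter_upwards [hopen.mem_nhds ⟨hs, hy⟩] with p hp
      exact hR p.1 ⟨hp.1.1.le, hp.1.2.le⟩ p.2 (le_of_lt hp.2)
    rw [this.fderiv_eq, fderiv_const_apply]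
  have key : ∀ v : ℝ × ℝ, Integrable
      (fun p : ℝ × ℝ => fderiv ℝ φ (p.1, softThreshold p.1 p.2) v)
      ((volume.restrict (Ioc 0 t)).prod μ₀) := by
    intro v
    have hv : Continuous fun p : ℝ × ℝ => fderiv ℝ φ (p.1, softThreshold p.1 p.2) v := by fun_prop
    have hK : IntegrableOn (fun p : ℝ × ℝ => fderiv ℝ φ (p.1, softThreshold p.1 p.2) v)
        (Icc 0 t ×ˢ closedBall 0 (R + T)) (volume.prod μ₀) :=
      hv.continuousOn.integrableOn_compact (isCompact_Icc.prod (isCompact_closedBall _ _))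
    rw [← Measure.restrict_univ (μ := μ₀), Measure.prod_restrict]
    refine hK.of_forall_sdiff_eq_zero (measurableSet_Ioc.prod .univ) ?_
    rintro ⟨s, x⟩ ⟨⟨hs, -⟩, hx⟩
    have hs' : s ∈ Ioo 0 T := ⟨hs.1, hs.2.trans_lt ht⟩
    have hx' : R + T < ‖x‖ := by
      by_contra! h
      exact hx ⟨⟨hs.1.le, hs.2⟩, by simpa using h⟩
    have := abs_le_abs_softThreshold_add hs'.1.le x
    rw [Real.norm_eq_abs] at hx'
    simp only
    rw [hzero s hs' (softThreshold s x) (by rw [Real.norm_eq_abs]; linarith [hs'.2])]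
    rfl
  refine (key (1, 0)).add ((key (0, 1)).bdd_mul (c := 1) ?_ ?_)
  · exact (measurable_bTilde.comp hX.measurable).aestronglyMeasurable
  · exact .of_forall fun p => norm_bTilde_le _

theorem integrable_comp_softThreshold {f : ℝ → ℝ} (hf : Continuous f) {R t : ℝ} (ht : 0 ≤ t)
    (hR : ∀ x : ℝ, R ≤ ‖x‖ → f x = 0) (μ₀ : Measure ℝ) [IsLocallyFiniteMeasure μ₀] :
    Integrable (fun x => f (softThreshold t x)) μ₀ := by
  have hX : Continuous (softThreshold t) := continuous_softThreshold.comp (Continuous.prodMk_right t)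
  refine (hf.comp hX).integrable_of_hasCompactSupport
    (HasCompactSupport.intro (isCompact_closedBall 0 (R + t)) fun x hx => hR _ ?_)
  have := abs_le_abs_softThreshold_add ht x
  rw [mem_closedBall_zero_iff, not_le, Real.norm_eq_abs] at hx
  rw [Real.norm_eq_abs]
  linarith

theorem measurable_softThreshold (t : ℝ) : Measurable (softThreshold t) :=
  (continuous_softThreshold.comp (Continuous.prodMk_right t)).measurable

theorem softThreshold_preimage_subset {t T R : ℝ} (ht : t ∈ Icc 0 T) {K : Set ℝ}
    (hK : K ⊆ closedBall 0 R) : softThreshold t ⁻¹' K ⊆ closedBall 0 (R + T) := by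
  intro x hx
  have h₁ := abs_le_abs_softThreshold_add ht.1 x
  have h₂ := hK hx
  rw [mem_closedBall_zero_iff, Real.norm_eq_abs] at h₂ ⊢
  linarith [ht.2]

theorem isLocallyFiniteMeasure_map_softThreshold (μ₀ : Measure ℝ) [IsLocallyFiniteMeasure μ₀]
    {t : ℝ} (ht : 0 ≤ t) : IsLocallyFiniteMeasure (μ₀.map (softThreshold t)) := by
  refine ⟨fun x => ⟨closedBall x 1, closedBall_mem_nhds x one_pos, ?_⟩⟩
  rw [Measure.map_apply (measurable_softThreshold t) measurableSet_closedBall]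
  exact (measure_mono (softThreshold_preimage_subset ⟨ht, le_rfl⟩
    (closedBall_subset_closedBall' (ε₂ := 1 + dist x 0) le_rfl))).trans_lt
    (isCompact_closedBall _ _).measure_lt_top

theorem isMeasurableFamily_map_softThreshold (T : ℝ) (μ₀ : Measure ℝ) [IsLocallyFiniteMeasure μ₀] :
    IsMeasurableFamily T fun t => μ₀.map (softThreshold t) := by
  have hmeas : ∀ B : Set ℝ, MeasurableSet B →
      Measurable fun t => μ₀.map (softThreshold t) B := by
    intro B hB
    simp_rw [fun t => Measure.map_apply (μ := μ₀) (measurable_softThreshold t) hB]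
    exact measurable_measure_prodMk_left (continuous_softThreshold.measurable hB)
  refine ⟨fun B hB _ => (hmeas B hB).aemeasurable, fun K hK => ?_⟩
  obtain ⟨R, hR⟩ := hK.isBounded.subset_closedBall 0
  refine Measure.integrableOn_of_bounded (M := (μ₀ (closedBall 0 (R + T))).toReal)
    (by simp) (hmeas K hK.measurableSet).ennreal_toReal.aestronglyMeasurable ?_
  filter_upwards [ae_restrict_mem measurableSet_Icc] with t ht
  rw [Real.norm_of_nonneg ENNReal.toReal_nonneg,
    Measure.map_apply (measurable_softThreshold t) hK.measurableSet]
  exact ENNReal.toReal_mono (isCompact_closedBall _ _).measure_lt_top.ne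
    (measure_mono (softThreshold_preimage_subset ht hR))

theorem isMVSolution_map_softThreshold (T : ℝ) (μ₀ : Measure ℝ) [IsLocallyFiniteMeasure μ₀] :
    IsMVSolution T (fun _ y => bTilde y) (fun t => μ₀.map (softThreshold t)) μ₀ := by
  rintro φ hφ ⟨R, -, hR⟩
  have hφc := hφ.continuous
  rw [← Measure.restrict_congr_set Ioo_ae_eq_Icc]
  filter_upwards [ae_restrict_mem measurableSet_Ioo] with t ht
  simp_rw [deriv_add_fderiv_eq_transportDeriv (hφ.differentiable one_ne_zero)]
  have hmap : ∀ s {f : ℝ → ℝ}, Measurable f →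
      ∫ x, f x ∂(μ₀.map (softThreshold s)) = ∫ x, f (softThreshold s x) ∂μ₀ := fun s f hf =>
    integral_map (measurable_softThreshold s).aemeasurable hf.aestronglyMeasurable
  rw [hmap t (f := fun x => φ (t, x)) (by fun_prop)]
  simp_rw [fun s => hmap s (measurable_transportDeriv hφ s)]
  have hT : 0 ≤ T := (ht.1.trans ht.2).le
  have hint := integrable_transportDeriv_softThreshold hφ hR ht.2 μ₀
  rw [intervalIntegral_integral_swap
    (f := fun s x => transportDeriv φ s (softThreshold s x)) (by rwa [uIoc_of_le ht.1.le])]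
  simp_rw [integral_transportDeriv_softThreshold hφ ht.1.le]
  have h₀ : Integrable (fun x => φ (0, x)) μ₀ := by
    simpa only [softThreshold_zero_left] using integrable_comp_softThreshold
      (f := fun x => φ (0, x)) (by fun_prop) le_rfl (hR 0 ⟨le_rfl, hT⟩) μ₀
  rw [integral_sub (integrable_comp_softThreshold (f := fun x => φ (t, x)) (by fun_prop) ht.1.le
    (hR t ⟨ht.1.le, ht.2.le⟩) μ₀) h₀]
  ring

/-- The curve `t ↦ softThreshold t x`, as an element of `Γ`. -/
def softThresholdCurve (T x : ℝ) : LipCurve T ℝ 1 :=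
  ⟨⟨fun t => softThreshold t x, by
    have := continuous_softThreshold
    fun_prop⟩,
    LipschitzWith.of_dist_le_mul fun s t => by
      simpa [Real.dist_eq, Subtype.dist_eq] using abs_softThreshold_sub_le s.2.1 t.2.1 x⟩

theorem continuous_softThresholdCurve (T : ℝ) : Continuous (softThresholdCurve T) := by
  refine Continuous.subtype_mk (ContinuousMap.continuous_of_continuous_uncurry _ ?_) _
  exact continuous_softThreshold.comp
    ((continuous_subtype_val.comp continuous_snd).prodMk continuous_fst)

theorem evalC_softThresholdCurve {T : ℝ} (hT : 0 ≤ T) (x : ℝ) {t : ℝ} (ht : t ∈ Icc 0 T) :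
    evalC hT (softThresholdCurve T x).1 t = softThreshold t x := by
  rw [evalC, projIcc_of_mem hT ht]
  rfl

theorem isIntegralCurveOf_softThresholdCurve {T : ℝ} (hT : 0 ≤ T) (x : ℝ) :
    IsIntegralCurveOf hT (fun _ y => bTilde y) (softThresholdCurve T x).1 := by
  intro t ht
  have h := integral_transportDeriv_softThreshold (φ := Prod.snd) contDiff_snd ht.1 x
  have hd : ∀ s y, transportDeriv Prod.snd s y = bTilde y := by
    intro s y
    simp [transportDeriv, fderiv_snd]
  simp_rw [hd] at h
  rw [evalC_softThresholdCurve hT x ht, evalC_softThresholdCurve hT x ⟨le_rfl, hT⟩,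
    softThreshold_zero_left, intervalIntegral.integral_congr
      (g := fun s => bTilde (softThreshold s x)), h]
  · ring
  · intro s hs
    rw [uIcc_of_le ht.1] at hs
    simp only
    rw [evalC_softThresholdCurve hT x ⟨hs.1, hs.2.trans ht.2⟩]

/-- For `b̃ = 1_{(-∞,0)} - 1_{(0,+∞)}`, there is a Borel flow `F : ℝ → Γ` (with
`Γ = Lip_1([0,T]; ℝ)` since `‖b̃‖_∞ = 1`): every `F x` is an integral curve of `b̃` starting
at `x`, explicitly given by `F(x)(t) = sign(x) · max(|x| - t, 0)`. Consequently, for every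
nonnegative locally finite Borel measure `μ̄` on `ℝ` the continuity equation
`∂_t μ_t + div (b̃ μ_t) = 0` with initial datum `μ̄` has a nonnegative measure-valued
solution. -/
theorem flow_and_mvs_for_bTilde (T : ℝ) (hT : 0 < T) :
    (∃ F : ℝ → LipCurve T ℝ 1, Measurable F ∧
      (∀ x, IsIntegralCurveOf hT.le (fun _ y => bTilde y) (F x).1 ∧
        evalC hT.le (F x).1 0 = x) ∧
      (∀ x, ∀ t ∈ Set.Icc (0:ℝ) T,
        evalC hT.le (F x).1 t = Real.sign x * max (|x| - t) 0)) ∧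
    (∀ μ₀ : Measure ℝ, IsLocallyFiniteMeasure μ₀ →
      ∃ μ : ℝ → Measure ℝ,
        (∀ t ∈ Set.Icc (0:ℝ) T, IsLocallyFiniteMeasure (μ t)) ∧
        IsMeasurableFamily T μ ∧
        IsMVSolution T (fun _ y => bTilde y) μ μ₀) := by
  refine ⟨⟨softThresholdCurve T, (continuous_softThresholdCurve T).measurable, fun x =>
    ⟨isIntegralCurveOf_softThresholdCurve hT.le x, ?_⟩, fun x t ht => ?_⟩, fun μ₀ _ =>
    ⟨fun t => μ₀.map (softThreshold t),
      fun t ht => isLocallyFiniteMeasure_map_softThreshold μ₀ ht.1,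
      isMeasurableFamily_map_softThreshold T μ₀, isMVSolution_map_softThreshold T μ₀⟩⟩
  · rw [evalC_softThresholdCurve hT.le x ⟨le_rfl, hT.le⟩, softThreshold_zero_left]
  · rw [evalC_softThresholdCurve hT.le x ht, softThreshold_eq_sign_mul ht.1]

end
end
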